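/- arXiv:2202.07966 — 2 statements merged into one kernel-verified Lean document; each statement's English description precedes it below -/
import Mathlib

section
/- Let n < m be positive integers and let M be an n × m integer matrix of full row rank n. Let g be the greatest common divisor of all n × n minors of M (so g > 0). Then there exists a nonzero vector x ∈ ℤ^m with Mx = 0 and ‖x‖_∞ ≤ ((1/g)·√(det(M Mᵀ)))^(1/(m−n)). -/
open MeasureTheory Set
open scoped ENNReal Matrix Pointwise

/-- Brunn–Minkowski on the real line, for compact sets. -/
lemma volume_add_volume_le_of_isCompact {A B C : Set ℝ} (hA : IsCompact A) (hB : IsCompact B)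
    (hA0 : A.Nonempty) (hB0 : B.Nonempty) (h : ∀ a ∈ A, ∀ b ∈ B, a + b ∈ C) :
    volume A + volume B ≤ volume C := by
  have ha := hA.sSup_mem hA0
  have hb := hB.sInf_mem hB0
  set a := sSup A
  set b := sInf B
  have h1 : volume A = volume ((fun x => x + b) '' A) := by
    rw [image_add_right, measure_preimage_add_right]
  have h2 : volume B = volume ((fun x => a + x) '' B) := by
    rw [image_add_left, measure_preimage_add]
  have hd : AEDisjoint volume ((fun x => x + b) '' A) ((fun x => a + x) '' B) := by
    refine measure_mono_null (t := {a + b}) ?_ (by simp)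
    rintro _ ⟨⟨x, hx, rfl⟩, ⟨y, hy, hxy⟩⟩
    have := le_csSup hA.bddAbove hx
    have := csInf_le hB.bddBelow hy
    simp only [mem_singleton_iff] at *
    linarith
  rw [h1, h2, ← measure_union₀ _ hd]
  · refine measure_mono ?_
    rintro _ (⟨x, hx, rfl⟩ | ⟨x, hx, rfl⟩)
    · exact h x hx b hb
    · exact h a ha x hx
  · exact ((hB.image (by fun_prop)).measurableSet).nullMeasurableSet

/-- Brunn–Minkowski on the real line. -/
lemma volume_add_volume_le {A B C : Set ℝ} (hA : MeasurableSet A) (hB : MeasurableSet B)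
    (hA0 : A.Nonempty) (hB0 : B.Nonempty) (h : ∀ a ∈ A, ∀ b ∈ B, a + b ∈ C) :
    volume A + volume B ≤ volume C := by
  obtain ⟨a, ha⟩ := hA0
  obtain ⟨b, hb⟩ := hB0
  rw [hA.measure_eq_iSup_isCompact, hB.measure_eq_iSup_isCompact]
  simp only [iSup_and']
  refine ENNReal.biSup_add_biSup_le' (p := fun K => K ⊆ A ∧ IsCompact K)
    (q := fun K => K ⊆ B ∧ IsCompact K) ⟨∅, empty_subset _, isCompact_empty⟩
    ⟨∅, empty_subset _, isCompact_empty⟩ ?_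
  rintro K ⟨hKA, hK⟩ K' ⟨hKB, hK'⟩
  calc volume K + volume K' ≤ volume (insert a K) + volume (insert b K') := by
        gcongr <;> exact subset_insert _ _
    _ ≤ volume C := volume_add_volume_le_of_isCompact (hK.insert a) (hK'.insert b)
        (insert_nonempty _ _) (insert_nonempty _ _)
        fun x hx y hy => h x (insert_subset ha hKA hx) y (insert_subset hb hKB hy)

lemma lintegral_eq_lintegral_meas_lt_of_le_one {f : ℝ → ℝ≥0∞} (hf : Measurable f)
    (h1 : ∀ x, f x ≤ 1) :
    ∫⁻ x, f x = ∫⁻ t in Ioo (0 : ℝ) 1, volume {x | ENNReal.ofReal t < f x} := by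
  have hfin : ∀ x, f x ≠ ∞ := fun x => ((h1 x).trans_lt ENNReal.one_lt_top).ne
  have hset : ∀ t ∈ Ioi (0 : ℝ), {x | t < (f x).toReal} = {x | ENNReal.ofReal t < f x} := by
    intro t ht
    ext x
    exact (ENNReal.ofReal_lt_iff_lt_toReal (le_of_lt ht) (hfin x)).symm
  calc ∫⁻ x, f x = ∫⁻ x, ENNReal.ofReal (f x).toReal := by
        simp only [ENNReal.ofReal_toReal (hfin _)]
    _ = ∫⁻ t in Ioi (0 : ℝ), volume {x | t < (f x).toReal} :=
        lintegral_eq_lintegral_meas_lt volume (by filter_upwards with x using by simp)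
          hf.ennreal_toReal.aemeasurable
    _ = ∫⁻ t in Ioi (0 : ℝ), volume {x | ENNReal.ofReal t < f x} :=
        setLIntegral_congr_fun measurableSet_Ioi fun t ht => by simp only [hset t ht]
    _ = ∫⁻ t in Ioo (0 : ℝ) 1, volume {x | ENNReal.ofReal t < f x} := by
        rw [← Ioo_union_Ici_eq_Ioi (zero_lt_one (α := ℝ)),
          lintegral_union measurableSet_Ici (by
            rw [Set.disjoint_left]; intro x hx hx'; exact absurd hx.2 (not_lt.2 hx'))]
        rw [setLIntegral_congr_fun (g := 0) measurableSet_Ici, Pi.zero_def, lintegral_zero, add_zero]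
        intro t ht
        have : {x | ENNReal.ofReal t < f x} = ∅ := by
          ext x
          simp only [mem_ofPred_eq, mem_empty_iff_false, iff_false, not_lt]
          exact (h1 x).trans (by simpa using ht)
        simp [this]

/-- The linear form of Prékopa–Leindler on the line, for functions with supremum `1`. -/
lemma lintegral_add_le_of_iSup_eq_one {a b : ℝ} (ha : 0 < a) (hb : 0 < b) {f g h : ℝ → ℝ≥0∞}
    (hf : Measurable f) (hg : Measurable g) (hh : Measurable h)
    (hf1 : ⨆ x, f x = 1) (hg1 : ⨆ x, g x = 1)
    (H : ∀ t x y, t < 1 → t < f x → t < g y → t < h (a * x + b * y)) :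
    ENNReal.ofReal a * (∫⁻ x, f x) + ENNReal.ofReal b * (∫⁻ x, g x) ≤ ∫⁻ x, h x := by
  have hm : Measurable fun x => min (h x) 1 := hh.min measurable_const
  have hmeas : ∀ f : ℝ → ℝ≥0∞,
      Measurable fun t : ℝ => volume {x | ENNReal.ofReal t < f x} := fun f =>
    Antitone.measurable fun s t hst => measure_mono fun x hx =>
      lt_of_le_of_lt (ENNReal.ofReal_le_ofReal hst) hx
  calc _ ≤ ∫⁻ x, min (h x) 1 := ?_
    _ ≤ _ := lintegral_mono fun x => min_le_left _ _
  rw [lintegral_eq_lintegral_meas_lt_of_le_one hf (fun x => hf1 ▸ le_iSup f x),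
    lintegral_eq_lintegral_meas_lt_of_le_one hg (fun x => hg1 ▸ le_iSup g x),
    lintegral_eq_lintegral_meas_lt_of_le_one hm (fun x => min_le_right _ _),
    ← lintegral_const_mul _ (hmeas f), ← lintegral_const_mul _ (hmeas g),
    ← lintegral_add_left ((hmeas f).const_mul _)]
  refine setLIntegral_mono (hmeas _) fun t ht => ?_
  have ht1 : ENNReal.ofReal t < 1 := by simpa using ht.2
  have key : ∀ (c : ℝ) (hc : 0 < c) (S : Set ℝ),
      ENNReal.ofReal c * volume S = volume ((fun x => c * x) '' S) := by
    intro c hc S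
    have := Measure.addHaar_smul (volume : Measure ℝ) c S
    simp only [Module.finrank_self, pow_one, abs_of_pos hc] at this
    rw [← this]; rfl
  have hmi : ∀ (c : ℝ) (hc : 0 < c) (S : Set ℝ), MeasurableSet S →
      MeasurableSet ((fun x => c * x) '' S) := fun c hc S hS =>
    hS.const_smul_of_ne_zero hc.ne'
  rw [key a ha, key b hb]
  refine volume_add_volume_le (hmi _ ha _ (measurableSet_lt measurable_const hf))
    (hmi _ hb _ (measurableSet_lt measurable_const hg)) ?_ ?_ ?_
  · exact (lt_iSup_iff.1 (hf1 ▸ ht1)).elim fun x hx => ⟨_, x, hx, rfl⟩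
  · exact (lt_iSup_iff.1 (hg1 ▸ ht1)).elim fun x hx => ⟨_, x, hx, rfl⟩
  · rintro _ ⟨x, hx, rfl⟩ _ ⟨y, hy, rfl⟩
    exact lt_min (H _ _ _ ht1 hx hy) ht1

lemma ENNReal.rpow_mul_rpow_le_add {a b : ℝ} (ha : 0 < a) (hb : 0 < b) (hab : a + b = 1)
    (x y : ℝ≥0∞) :
    x ^ a * y ^ b ≤ ENNReal.ofReal a * x + ENNReal.ofReal b * y := by
  have hpq : (1 / a).HolderConjugate (1 / b) := by
    refine Real.holderConjugate_iff.2 ⟨?_, by simpa using hab⟩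
    rw [lt_div_iff₀ ha]; linarith
  refine (ENNReal.young_inequality _ _ hpq).trans_eq ?_
  rw [← ENNReal.rpow_mul, ← ENNReal.rpow_mul, mul_one_div_cancel ha.ne', mul_one_div_cancel hb.ne',
    ENNReal.rpow_one, ENNReal.rpow_one, one_div, one_div, ENNReal.ofReal_inv_of_pos ha,
    ENNReal.ofReal_inv_of_pos hb, ENNReal.div_eq_inv_mul, ENNReal.div_eq_inv_mul, inv_inv, inv_inv]

/-- The one-dimensional Prékopa–Leindler inequality, for bounded functions. -/
lemma prekopaLeindler_real_of_bounded {a b : ℝ} (ha : 0 < a) (hb : 0 < b) (hab : a + b = 1)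
    {f g h : ℝ → ℝ≥0∞} (hf : Measurable f) (hg : Measurable g) (hh : Measurable h)
    (hft : ⨆ x, f x ≠ ∞) (hgt : ⨆ x, g x ≠ ∞)
    (H : ∀ x y, f x ^ a * g y ^ b ≤ h (a * x + b * y)) :
    (∫⁻ x, f x) ^ a * (∫⁻ x, g x) ^ b ≤ ∫⁻ x, h x := by
  rcases eq_or_ne (⨆ x, f x) 0 with hf0 | hf0
  · have : ∀ x, f x = 0 := by simpa using hf0
    simp [this, ha]
  rcases eq_or_ne (⨆ x, g x) 0 with hg0 | hg0
  · have : ∀ x, g x = 0 := by simpa using hg0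
    simp [this, hb]
  set α := ⨆ x, f x
  set β := ⨆ x, g x
  have hαa : α ^ a ≠ 0 := by simp [hf0, hft, ENNReal.rpow_eq_zero_iff]
  have hαt : α ^ a ≠ ∞ := ENNReal.rpow_ne_top_of_nonneg ha.le hft
  have hβb : β ^ b ≠ 0 := by simp [hg0, hgt, ENNReal.rpow_eq_zero_iff]
  have hβt : β ^ b ≠ ∞ := ENNReal.rpow_ne_top_of_nonneg hb.le hgt
  have hγ0 : α ^ a * β ^ b ≠ 0 := mul_ne_zero hαa hβb
  have hγt : α ^ a * β ^ b ≠ ∞ := ENNReal.mul_ne_top hαt hβt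
  have key := lintegral_add_le_of_iSup_eq_one ha hb (f := fun x => f x / α) (g := fun x => g x / β)
    (h := fun x => h x / (α ^ a * β ^ b)) (hf.div_const _) (hg.div_const _) (hh.div_const _)
    (by rw [← ENNReal.iSup_div]; exact ENNReal.div_self hf0 hft)
    (by rw [← ENNReal.iSup_div]; exact ENNReal.div_self hg0 hgt) (by
      intro t x y _ hx hy
      have h1 : t < (f x / α) ^ a * (g y / β) ^ b := by
        calc t = t ^ a * t ^ b := by
              rw [← ENNReal.rpow_add_of_nonneg _ _ ha.le hb.le, hab, ENNReal.rpow_one]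
          _ < _ := ENNReal.mul_lt_mul (ENNReal.rpow_lt_rpow hx ha) (ENNReal.rpow_lt_rpow hy hb)
      refine h1.trans_le ?_
      rw [ENNReal.div_rpow_of_nonneg _ _ ha.le, ENNReal.div_rpow_of_nonneg _ _ hb.le,
        ← ENNReal.mul_div_mul_comm (Or.inl hαa) (Or.inl hαt)]
      gcongr
      exact H x y)
  have key2 := (ENNReal.rpow_mul_rpow_le_add ha hb hab _ _).trans key
  simp only [div_eq_mul_inv] at key2
  rw [lintegral_mul_const _ hf, lintegral_mul_const _ hg, lintegral_mul_const _ hh,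
    ← div_eq_mul_inv, ← div_eq_mul_inv, ← div_eq_mul_inv,
    ENNReal.div_rpow_of_nonneg _ _ ha.le, ENNReal.div_rpow_of_nonneg _ _ hb.le,
    ← ENNReal.mul_div_mul_comm (Or.inl hαa) (Or.inl hαt),
    ENNReal.div_le_iff hγ0 hγt, ENNReal.div_mul_cancel hγ0 hγt] at key2
  exact key2

lemma lintegral_eq_iSup_lintegral_min {f : ℝ → ℝ≥0∞} (hf : Measurable f) :
    ∫⁻ x, f x = ⨆ N : ℕ, ∫⁻ x, min (f x) N := by
  rw [← lintegral_iSup (fun N => hf.min measurable_const)]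
  · refine lintegral_congr fun x => ?_
    rw [← inf_iSup_eq, ENNReal.iSup_natCast, inf_top_eq]
  · intro N N' h x
    exact min_le_min_left _ (by exact_mod_cast h)

/-- The one-dimensional Prékopa–Leindler inequality. -/
lemma prekopaLeindler_real {a b : ℝ} (ha : 0 < a) (hb : 0 < b) (hab : a + b = 1)
    {f g h : ℝ → ℝ≥0∞} (hf : Measurable f) (hg : Measurable g) (hh : Measurable h)
    (H : ∀ x y, f x ^ a * g y ^ b ≤ h (a * x + b * y)) :
    (∫⁻ x, f x) ^ a * (∫⁻ x, g x) ^ b ≤ ∫⁻ x, h x := by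
  have hr : ∀ (c : ℝ) (_ : 0 < c) (u : ℕ → ℝ≥0∞), (⨆ N, u N) ^ c = ⨆ N, u N ^ c :=
    fun c hc u => (ENNReal.orderIsoRpow c hc).map_iSup u
  have hbd : ∀ (f : ℝ → ℝ≥0∞) (N : ℕ), ⨆ x, min (f x) N ≠ ∞ := fun f N =>
    ((iSup_le fun x => min_le_right _ _).trans_lt (ENNReal.natCast_lt_top N)).ne
  rw [lintegral_eq_iSup_lintegral_min hf, lintegral_eq_iSup_lintegral_min hg, hr a ha, hr b hb,
    ENNReal.iSup_mul]
  simp only [ENNReal.mul_iSup]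
  refine iSup_le fun N => iSup_le fun N' =>
    prekopaLeindler_real_of_bounded ha hb hab (hf.min measurable_const) (hg.min measurable_const)
      hh (hbd f N) (hbd g N') fun x y => le_trans ?_ (H x y)
  gcongr <;> exact min_le_left _ _

lemma lintegral_fin_cons {k : ℕ} {f : (Fin (k + 1) → ℝ) → ℝ≥0∞} (hf : Measurable f) :
    ∫⁻ x, f x = ∫⁻ t, ∫⁻ y, f (Fin.cons t y) := by
  rw [← (volume_preserving_piFinSuccAbove (fun _ => ℝ) 0).symm.lintegral_comp hf]
  rw [Measure.volume_eq_prod, lintegral_prod _ (by fun_prop)]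
  refine lintegral_congr fun t => lintegral_congr fun y => ?_
  congr 1
  simp [MeasurableEquiv.piFinSuccAbove, Fin.consEquiv]

lemma measurable_fin_cons (k : ℕ) :
    Measurable fun p : ℝ × (Fin k → ℝ) => (Fin.cons p.1 p.2 : Fin (k + 1) → ℝ) :=
  measurable_pi_lambda _ fun i => by
    refine Fin.cases ?_ (fun j => ?_) i
    · exact measurable_fst
    · exact (measurable_pi_apply j).comp measurable_snd

lemma fin_cons_combination {k : ℕ} (a b s t : ℝ) (y z : Fin k → ℝ) :
    a • (Fin.cons s y : Fin (k + 1) → ℝ) + b • (Fin.cons t z : Fin (k + 1) → ℝ)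
      = Fin.cons (a * s + b * t) (a • y + b • z) := by
  ext i
  refine Fin.cases ?_ (fun j => ?_) i <;> simp

/-- The Prékopa–Leindler inequality. -/
theorem prekopaLeindler {a b : ℝ} (ha : 0 < a) (hb : 0 < b) (hab : a + b = 1) {k : ℕ}
    {f g h : (Fin k → ℝ) → ℝ≥0∞} (hf : Measurable f) (hg : Measurable g) (hh : Measurable h)
    (H : ∀ x y, f x ^ a * g y ^ b ≤ h (a • x + b • y)) :
    (∫⁻ x, f x) ^ a * (∫⁻ x, g x) ^ b ≤ ∫⁻ x, h x := by
  induction k with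
  | zero =>
    have h1 : (volume : Measure (Fin 0 → ℝ)) univ = 1 := by simp [volume_pi]
    simp only [lintegral_unique, h1, mul_one]
    exact (H _ _).trans_eq (congrArg h (Subsingleton.elim _ _))
  | succ k ih =>
    have hc := measurable_fin_cons k
    rw [lintegral_fin_cons hf, lintegral_fin_cons hg, lintegral_fin_cons hh]
    refine prekopaLeindler_real ha hb hab (hf.comp hc).lintegral_prod_right'
      (hg.comp hc).lintegral_prod_right' (hh.comp hc).lintegral_prod_right' fun s t => ?_
    refine ih (hf.comp (hc.comp measurable_prodMk_left)) (hg.comp (hc.comp measurable_prodMk_left))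
      (hh.comp (hc.comp measurable_prodMk_left)) fun y z => ?_
    simpa only [Function.comp_apply, fin_cons_combination] using H (Fin.cons s y) (Fin.cons t z)

/-- Measurable, even and log-concave functions with values in `[0, ∞]`. -/
structure IsEvenLogConcave {E : Type*} [AddCommGroup E] [Module ℝ E] [MeasurableSpace E]
    (f : E → ℝ≥0∞) : Prop where
  measurable : Measurable f
  even : ∀ x, f (-x) = f x
  logConcave : ∀ ⦃a b : ℝ⦄, 0 < a → 0 < b → a + b = 1 →
    ∀ x y, f x ^ a * f y ^ b ≤ f (a • x + b • y)

namespace IsEvenLogConcave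

variable {E E' : Type*} [AddCommGroup E] [Module ℝ E] [MeasurableSpace E]
  [AddCommGroup E'] [Module ℝ E'] [MeasurableSpace E']

lemma one : IsEvenLogConcave (fun _ : E => (1 : ℝ≥0∞)) :=
  ⟨measurable_const, fun _ => rfl, fun a b _ _ _ x y => by simp⟩

lemma mul {f g : E → ℝ≥0∞} (hf : IsEvenLogConcave f) (hg : IsEvenLogConcave g) :
    IsEvenLogConcave fun x => f x * g x := by
  refine ⟨hf.measurable.mul hg.measurable, fun x => by rw [hf.even, hg.even],
    fun a b ha hb hab x y => ?_⟩
  rw [ENNReal.mul_rpow_of_nonneg _ _ ha.le, ENNReal.mul_rpow_of_nonneg _ _ hb.le,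
    mul_mul_mul_comm]
  exact mul_le_mul' (hf.logConcave ha hb hab x y) (hg.logConcave ha hb hab x y)

lemma prod {ι : Type*} {f : ι → E → ℝ≥0∞} (s : Finset ι) (hf : ∀ i, IsEvenLogConcave (f i)) :
    IsEvenLogConcave fun x => ∏ i ∈ s, f i x := by
  classical
  induction s using Finset.induction_on with
  | empty => simpa using one
  | insert i s hi ih => simpa only [Finset.prod_insert hi] using (hf i).mul ih

lemma comp_linearMap {f : E' → ℝ≥0∞} (hf : IsEvenLogConcave f) (T : E →ₗ[ℝ] E')
    (hT : Measurable T) : IsEvenLogConcave fun x => f (T x) :=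
  ⟨hf.measurable.comp hT, fun x => by rw [map_neg, hf.even], fun a b ha hb hab x y => by
    simpa using hf.logConcave ha hb hab (T x) (T y)⟩

lemma marginal {k : ℕ} {f : (Fin (k + 1) → ℝ) → ℝ≥0∞} (hf : IsEvenLogConcave f) :
    IsEvenLogConcave fun t : ℝ => ∫⁻ y, f (Fin.cons t y) := by
  have hc := measurable_fin_cons k
  have hm : ∀ t, Measurable fun y => f (Fin.cons t y) := fun t =>
    hf.measurable.comp (hc.comp measurable_prodMk_left)
  refine ⟨(hf.measurable.comp hc).lintegral_prod_right', fun t => ?_, fun a b ha hb hab s t => ?_⟩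
  · rw [← lintegral_neg_eq_self]
    refine lintegral_congr fun y => ?_
    rw [← hf.even]
    congr 1
    ext i
    refine Fin.cases ?_ (fun j => ?_) i <;> simp
  · refine prekopaLeindler ha hb hab (hm s) (hm t) (hm _) fun y z => ?_
    simpa only [fin_cons_combination, smul_eq_mul] using
      hf.logConcave ha hb hab (Fin.cons s y) (Fin.cons t z)

lemma le_of_abs_le {f : ℝ → ℝ≥0∞} (hf : IsEvenLogConcave f) {s t : ℝ} (h : |s| ≤ |t|) :
    f t ≤ f s := by
  rcases h.eq_or_lt with h | h
  · rcases abs_eq_abs.1 h with rfl | rfl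
    · rfl
    · rw [hf.even]
  have ht : t ≠ 0 := by rintro rfl; simp at h; exact absurd h (not_lt.2 (abs_nonneg s))
  have hst : |s / t| < 1 := by rwa [abs_div, div_lt_one (abs_pos.2 ht)]
  obtain ⟨h1, h2⟩ := abs_lt.1 hst
  have key := hf.logConcave (a := (1 + s / t) / 2) (b := (1 - s / t) / 2) (by linarith)
    (by linarith) (by ring) t (-t)
  rw [hf.even, ← ENNReal.rpow_add_of_nonneg _ _ (by linarith) (by linarith)] at key
  have e1 : (1 + s / t) / 2 + (1 - s / t) / 2 = 1 := by ring
  have e2 : ((1 + s / t) / 2) • t + ((1 - s / t) / 2) • (-t) = s := by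
    simp only [smul_eq_mul]; field_simp; ring
  rwa [e1, e2, ENNReal.rpow_one] at key

end IsEvenLogConcave

/-- The density of the uniform distribution on `[-1/2, 1/2]`. -/
noncomputable def unitIntervalDensity : ℝ → ℝ≥0∞ := (Icc (-(1 / 2)) (1 / 2)).indicator 1

/-- The Gaussian density `exp (-π t²)`. -/
noncomputable def gaussianDensity (t : ℝ) : ℝ≥0∞ := ENNReal.ofReal (Real.exp (-Real.pi * t ^ 2))

lemma unitIntervalDensity_of_abs_le {t : ℝ} (h : |t| ≤ 1 / 2) : unitIntervalDensity t = 1 :=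
  indicator_of_mem (mem_Icc.2 (abs_le.1 h)) _

lemma unitIntervalDensity_of_lt_abs {t : ℝ} (h : 1 / 2 < |t|) : unitIntervalDensity t = 0 :=
  indicator_of_notMem (fun ht => not_le.2 h (abs_le.2 (mem_Icc.1 ht))) _

lemma isEvenLogConcave_unitIntervalDensity : IsEvenLogConcave unitIntervalDensity := by
  refine ⟨measurable_one.indicator measurableSet_Icc, fun x => ?_, fun a b ha hb hab x y => ?_⟩
  · rcases le_or_gt |x| (1 / 2) with h | h
    · rw [unitIntervalDensity_of_abs_le h, unitIntervalDensity_of_abs_le (by rwa [abs_neg])]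
    · rw [unitIntervalDensity_of_lt_abs h, unitIntervalDensity_of_lt_abs (by rwa [abs_neg])]
  · rcases le_or_gt |x| (1 / 2) with hx | hx
    · rcases le_or_gt |y| (1 / 2) with hy | hy
      · rw [unitIntervalDensity_of_abs_le hx, unitIntervalDensity_of_abs_le hy,
          unitIntervalDensity_of_abs_le]
        · simp
        · rw [abs_le] at *
          simp only [smul_eq_mul]
          constructor <;> nlinarith
      · simp [unitIntervalDensity_of_lt_abs hy, hb]
    · simp [unitIntervalDensity_of_lt_abs hx, ha]

lemma isEvenLogConcave_gaussianDensity : IsEvenLogConcave gaussianDensity := by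
  refine ⟨by unfold gaussianDensity; fun_prop, fun x => by simp [gaussianDensity],
    fun a b ha hb hab x y => ?_⟩
  simp only [gaussianDensity]
  rw [ENNReal.ofReal_rpow_of_pos (Real.exp_pos _), ENNReal.ofReal_rpow_of_pos (Real.exp_pos _),
    ← Real.exp_mul, ← Real.exp_mul, ← ENNReal.ofReal_mul (Real.exp_pos _).le, ← Real.exp_add]
  refine ENNReal.ofReal_le_ofReal (Real.exp_le_exp.2 ?_)
  have hb' : b = 1 - a := by linarith
  subst hb'
  have : 0 ≤ Real.pi * (a * (1 - a) * (x - y) ^ 2) := by positivity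
  simp only [smul_eq_mul]
  nlinarith

lemma lintegral_unitIntervalDensity : ∫⁻ t, unitIntervalDensity t = 1 := by
  rw [unitIntervalDensity, lintegral_indicator_one measurableSet_Icc, Real.volume_Icc]
  norm_num

lemma lintegral_gaussianDensity : ∫⁻ t, gaussianDensity t = 1 := by
  unfold gaussianDensity
  rw [← ofReal_integral_eq_lintegral_ofReal (integrable_exp_neg_mul_sq Real.pi_pos)
    (by filter_upwards with x using (Real.exp_pos _).le), integral_gaussian]
  simp [Real.pi_ne_zero]

lemma gaussianDensity_le_one (t : ℝ) : gaussianDensity t ≤ 1 := by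
  rw [gaussianDensity, ENNReal.ofReal_le_one, Real.exp_le_one_iff]
  nlinarith [Real.pi_pos, mul_nonneg Real.pi_pos.le (sq_nonneg t)]

/-- The uniform distribution on `[-1/2, 1/2]` is more peaked than the Gaussian. -/
lemma lintegral_gaussianDensity_mul_le {F : ℝ → ℝ≥0∞} (hF : IsEvenLogConcave F) :
    ∫⁻ t, gaussianDensity t * F t ≤ ∫⁻ t, unitIntervalDensity t * F t := by
  have hχ := isEvenLogConcave_unitIntervalDensity.measurable
  have hγ := isEvenLogConcave_gaussianDensity.measurable
  rcases eq_or_ne (F (1 / 2)) ∞ with hc | hc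
  · refine le_of_le_of_eq le_top (Eq.symm (top_le_iff.1 ?_))
    calc ∞ = ∫⁻ t, unitIntervalDensity t * ∞ := by
          rw [lintegral_mul_const _ hχ, lintegral_unitIntervalDensity, one_mul]
      _ ≤ _ := lintegral_mono fun t => by
          rcases le_or_gt |t| (1 / 2) with h | h
          · have : F (1 / 2) ≤ F t := hF.le_of_abs_le (h.trans (le_abs_self _))
            exact mul_le_mul_right (hc ▸ this) _
          · simp [unitIntervalDensity_of_lt_abs h]
  · set c := F (1 / 2)
    have key : ∫⁻ t, (gaussianDensity t * F t + unitIntervalDensity t * c)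
        ≤ ∫⁻ t, (unitIntervalDensity t * F t + gaussianDensity t * c) := by
      refine lintegral_mono fun t => ?_
      rcases le_or_gt |t| (1 / 2) with h | h
      · have hle : c ≤ F t := hF.le_of_abs_le (h.trans (le_abs_self _))
        rw [unitIntervalDensity_of_abs_le h, one_mul, one_mul]
        obtain ⟨r, hr⟩ := exists_add_of_le (gaussianDensity_le_one t)
        calc gaussianDensity t * F t + c = gaussianDensity t * F t + (gaussianDensity t + r) * c := by
              rw [← hr, one_mul]
          _ ≤ gaussianDensity t * F t + (gaussianDensity t * c + r * F t) := by
              rw [add_mul]; gcongr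
          _ = (gaussianDensity t + r) * F t + gaussianDensity t * c := by ring
          _ = F t + gaussianDensity t * c := by rw [← hr, one_mul]
      · have hle : F t ≤ c := hF.le_of_abs_le (by rw [abs_of_pos (by norm_num)]; exact h.le)
        rw [unitIntervalDensity_of_lt_abs h, zero_mul, zero_mul, add_zero, zero_add]
        gcongr
    rw [lintegral_add_right _ (hχ.mul_const c), lintegral_add_right _ (hγ.mul_const c),
      lintegral_mul_const _ hχ, lintegral_mul_const _ hγ, lintegral_unitIntervalDensity,
      lintegral_gaussianDensity, one_mul] at key
    exact (ENNReal.add_le_add_iff_right hc).1 key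

lemma lintegral_comp_mulVec {ι : Type*} [Fintype ι] [DecidableEq ι] {N : Matrix ι ι ℝ}
    (hN : N.det ≠ 0) {f : (ι → ℝ) → ℝ≥0∞} (hf : Measurable f) :
    ∫⁻ x, f (N *ᵥ x) = ENNReal.ofReal |N.det⁻¹| * ∫⁻ x, f x := by
  have h : ∫⁻ x, f x ∂(Measure.map (Matrix.toLin' N) volume)
      = ∫⁻ x, f x ∂(ENNReal.ofReal |N.det⁻¹| • volume) := by
    rw [Real.map_matrix_volume_pi_eq_smul_volume_pi hN]
  rw [lintegral_map hf (LinearMap.continuous_on_pi _).measurable, lintegral_smul_measure] at h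
  exact h

lemma exists_det_ne_zero_mulVec_zero_eq_dotProduct {k : ℕ} {v : Fin (k + 1) → ℝ} (hv : v ≠ 0) :
    ∃ N : Matrix (Fin (k + 1)) (Fin (k + 1)) ℝ, N.det ≠ 0 ∧ ∀ x, (N *ᵥ x) 0 = v ⬝ᵥ x := by
  have h0 : (Pi.single 0 1 : Fin (k + 1) → ℝ) ≠ 0 := by simp
  obtain ⟨A, hA⟩ := SeparatingDual.exists_continuousLinearEquiv_apply_eq (R := ℝ) h0 hv
  set P := LinearMap.toMatrix' (A.toLinearEquiv : (Fin (k + 1) → ℝ) →ₗ[ℝ] (Fin (k + 1) → ℝ)) with hP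
  have hP0 : P *ᵥ Pi.single 0 1 = v := by
    rw [hP, LinearMap.toMatrix'_mulVec]; exact hA
  refine ⟨Pᵀ, ?_, fun x => ?_⟩
  · rw [Matrix.det_transpose, hP, LinearMap.det_toMatrix']
    exact (LinearEquiv.isUnit_det' A.toLinearEquiv).ne_zero
  · rw [← hP0, Matrix.mulVec_single_one]
    rfl

/-- Replacing a Gaussian factor depending on a linear form by a uniform one increases the integral
of an even log-concave function. -/
lemma lintegral_gaussianDensity_dotProduct_mul_le {d : ℕ} (v : Fin d → ℝ)
    {f : (Fin d → ℝ) → ℝ≥0∞} (hf : IsEvenLogConcave f) :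
    ∫⁻ x, gaussianDensity (v ⬝ᵥ x) * f x ≤ ∫⁻ x, unitIntervalDensity (v ⬝ᵥ x) * f x := by
  rcases eq_or_ne v 0 with rfl | hv
  · refine lintegral_mono fun x => ?_
    rw [zero_dotProduct, unitIntervalDensity_of_abs_le (by simp)]
    gcongr
    exact gaussianDensity_le_one 0
  obtain _ | k := d
  · exact absurd (Subsingleton.elim _ _) hv
  obtain ⟨N, hN, hNv⟩ := exists_det_ne_zero_mulVec_zero_eq_dotProduct hv
  have hf' : IsEvenLogConcave fun z => f (N⁻¹ *ᵥ z) :=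
    hf.comp_linearMap (Matrix.toLin' N⁻¹) (LinearMap.continuous_on_pi _).measurable
  have key : ∀ φ : ℝ → ℝ≥0∞, Measurable φ → ∫⁻ x, φ (v ⬝ᵥ x) * f x
      = ENNReal.ofReal |N.det⁻¹| * ∫⁻ t, φ t * ∫⁻ y, f (N⁻¹ *ᵥ Fin.cons t y) := by
    intro φ hφ
    have hm : Measurable fun z : Fin (k + 1) → ℝ => φ (z 0) * f (N⁻¹ *ᵥ z) :=
      (hφ.comp (measurable_pi_apply 0)).mul hf'.measurable
    have h1 := lintegral_comp_mulVec hN hm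
    simp only [hNv, Matrix.mulVec_mulVec, Matrix.nonsing_inv_mul _ hN.isUnit,
      Matrix.one_mulVec] at h1
    rw [h1, lintegral_fin_cons hm]
    congr 1
    refine lintegral_congr fun t => ?_
    simp only [Fin.cons_zero]
    exact lintegral_const_mul _
      (hf'.measurable.comp ((measurable_fin_cons k).comp measurable_prodMk_left))
  rw [key _ isEvenLogConcave_gaussianDensity.measurable,
    key _ isEvenLogConcave_unitIntervalDensity.measurable]
  gcongr 1
  exact lintegral_gaussianDensity_mul_le hf'.marginal

lemma IsEvenLogConcave.comp_dotProduct {d : ℕ} {φ : ℝ → ℝ≥0∞} (hφ : IsEvenLogConcave φ)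
    (v : Fin d → ℝ) : IsEvenLogConcave fun x : Fin d → ℝ => φ (v ⬝ᵥ x) :=
  hφ.comp_linearMap (dotProductBilin ℝ ℝ v) (LinearMap.continuous_on_pi _).measurable

lemma lintegral_prod_gaussianDensity_mulVec_le {ι : Type*} [Fintype ι] {d : ℕ}
    (A : Matrix ι (Fin d) ℝ) :
    ∫⁻ x, ∏ i, gaussianDensity ((A *ᵥ x) i) ≤ ∫⁻ x, ∏ i, unitIntervalDensity ((A *ᵥ x) i) := by
  classical
  have key : ∀ S : Finset ι, ∫⁻ x, ∏ i, gaussianDensity ((A *ᵥ x) i) ≤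
      ∫⁻ x, ∏ i, (if i ∈ S then unitIntervalDensity else gaussianDensity) ((A *ᵥ x) i) := by
    intro S
    induction S using Finset.induction_on with
    | empty => simp
    | insert j S hj ih =>
      refine ih.trans ?_
      have hR : IsEvenLogConcave fun x : Fin d → ℝ => ∏ i ∈ Finset.univ.erase j,
          (if i ∈ S then unitIntervalDensity else gaussianDensity) ((A *ᵥ x) i) :=
        .prod _ fun i => by
          split_ifs
          · exact isEvenLogConcave_unitIntervalDensity.comp_dotProduct (A i)
          · exact isEvenLogConcave_gaussianDensity.comp_dotProduct (A i)
      refine (Eq.trans_le ?_ (lintegral_gaussianDensity_dotProduct_mul_le (A j) hR)).trans_eq ?_ <;>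
        refine lintegral_congr fun x => ?_
      · rw [← Finset.mul_prod_erase _ _ (Finset.mem_univ j), if_neg hj]
        rfl
      · rw [← Finset.mul_prod_erase _ _ (Finset.mem_univ j), if_pos (Finset.mem_insert_self _ _)]
        refine congrArg _ (Finset.prod_congr rfl fun i hi => ?_)
        simp only [Finset.mem_insert, Finset.ne_of_mem_erase hi, false_or]
  simpa using key Finset.univ

lemma lintegral_prod_gaussianDensity (d : ℕ) :
    ∫⁻ x : Fin d → ℝ, ∏ i, gaussianDensity (x i) = 1 := by
  have h : ∀ x : Fin d → ℝ, ∏ i, gaussianDensity (x i)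
      = ENNReal.ofReal (∏ i, Real.exp (-Real.pi * x i ^ 2)) := fun x => by
    rw [ENNReal.ofReal_prod_of_nonneg fun i _ => (Real.exp_pos _).le]
    rfl
  simp only [h]
  rw [volume_pi, ← ofReal_integral_eq_lintegral_ofReal
    (Integrable.fintype_prod fun _ => integrable_exp_neg_mul_sq Real.pi_pos)
    (by filter_upwards with x using Finset.prod_nonneg fun i _ => (Real.exp_pos _).le),
    ← volume_pi, integral_fintype_prod_volume_eq_pow (fun t : ℝ => Real.exp (-Real.pi * t ^ 2)),
    integral_gaussian]
  simp [Real.pi_ne_zero]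

lemma prod_gaussianDensity {ι : Type*} [Fintype ι] (v : ι → ℝ) :
    ∏ i, gaussianDensity (v i) = ENNReal.ofReal (Real.exp (-Real.pi * (v ⬝ᵥ v))) := by
  simp only [gaussianDensity]
  rw [← ENNReal.ofReal_prod_of_nonneg fun i _ => (Real.exp_pos _).le, ← Real.exp_sum,
    ← Finset.mul_sum]
  simp only [dotProduct, pow_two]

open scoped MatrixOrder in
lemma exists_transpose_mul_self_eq {d : ℕ} {G : Matrix (Fin d) (Fin d) ℝ} (hG : G.PosSemidef) :
    ∃ S : Matrix (Fin d) (Fin d) ℝ, Sᵀ * S = G := by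
  refine ⟨CFC.sqrt G, ?_⟩
  have h : (CFC.sqrt G)ᵀ = CFC.sqrt G :=
    (Matrix.nonneg_iff_posSemidef.1 (CFC.sqrt_nonneg G)).isHermitian
  rw [h, CFC.sqrt_mul_sqrt_self G hG.nonneg]

/-- The integral of the Gaussian with quadratic form `Aᵀ A`. -/
lemma lintegral_prod_gaussianDensity_mulVec {ι : Type*} [Fintype ι] {d : ℕ}
    (A : Matrix ι (Fin d) ℝ) (hA : (Aᵀ * A).det ≠ 0) :
    ∫⁻ x, ∏ i, gaussianDensity ((A *ᵥ x) i) = ENNReal.ofReal (√(Aᵀ * A).det)⁻¹ := by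
  obtain ⟨S, hS⟩ := exists_transpose_mul_self_eq (Matrix.posSemidef_conjTranspose_mul_self A)
  rw [Matrix.conjTranspose_eq_transpose_of_trivial] at hS
  have hdet : (Aᵀ * A).det = S.det ^ 2 := by
    rw [← hS, Matrix.det_mul, Matrix.det_transpose, pow_two]
  have hS0 : S.det ≠ 0 := fun h => hA (by rw [hdet, h]; simp)
  have hq : ∀ x, (A *ᵥ x) ⬝ᵥ (A *ᵥ x) = (S *ᵥ x) ⬝ᵥ (S *ᵥ x) := fun x => by
    rw [Matrix.dotProduct_mulVec, Matrix.dotProduct_mulVec, ← Matrix.mulVec_transpose,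
      ← Matrix.mulVec_transpose, Matrix.mulVec_mulVec, Matrix.mulVec_mulVec, hS]
  have hm : Measurable fun x : Fin d → ℝ => ∏ i, gaussianDensity (x i) :=
    Finset.measurable_prod _ fun i _ =>
      isEvenLogConcave_gaussianDensity.measurable.comp (measurable_pi_apply i)
  calc ∫⁻ x, ∏ i, gaussianDensity ((A *ᵥ x) i) = ∫⁻ x, ∏ i, gaussianDensity ((S *ᵥ x) i) := by
        simp only [prod_gaussianDensity, hq]
    _ = ENNReal.ofReal (√(Aᵀ * A).det)⁻¹ := by
        rw [lintegral_comp_mulVec hS0 hm, lintegral_prod_gaussianDensity, mul_one, hdet,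
          Real.sqrt_sq_eq_abs, abs_inv]

/-- **Vaaler's cube slicing theorem**, for the section of the unit cube by the range of `A`. -/
theorem ofReal_inv_sqrt_det_le_volume {ι : Type*} [Fintype ι] {d : ℕ}
    (A : Matrix ι (Fin d) ℝ) (hA : (Aᵀ * A).det ≠ 0) :
    ENNReal.ofReal (√(Aᵀ * A).det)⁻¹ ≤ volume {x : Fin d → ℝ | ∀ i, |(A *ᵥ x) i| ≤ 1 / 2} := by
  rw [← lintegral_prod_gaussianDensity_mulVec A hA]
  refine (lintegral_prod_gaussianDensity_mulVec_le A).trans ?_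
  rw [← setLIntegral_one]
  refine (lintegral_mono fun x => ?_).trans (lintegral_indicator_le _ _)
  by_cases hx : ∀ i, |(A *ᵥ x) i| ≤ 1 / 2
  · rw [indicator_of_mem (s := {x | ∀ i, |(A *ᵥ x) i| ≤ 1 / 2}) hx]
    exact (Finset.prod_eq_one fun i _ => unitIntervalDensity_of_abs_le (hx i)).le
  · push Not at hx
    obtain ⟨i, hi⟩ := hx
    rw [Finset.prod_eq_zero (Finset.mem_univ i) (unitIntervalDensity_of_lt_abs hi)]
    exact zero_le

lemma Matrix.mulVec_injective_of_det_transpose_mul_self_ne_zero {R ι κ : Type*} [CommRing R]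
    [IsDomain R] [Fintype ι] [Fintype κ] [DecidableEq κ] {A : Matrix ι κ R}
    (hA : (Aᵀ * A).det ≠ 0) : Function.Injective A.mulVec := by
  refine fun x y hxy => sub_eq_zero.1 ?_
  refine Matrix.eq_zero_of_mulVec_eq_zero hA ?_
  rw [← Matrix.mulVec_mulVec, Matrix.mulVec_sub, sub_eq_zero.2 hxy, Matrix.mulVec_zero]

lemma Matrix.det_transpose_mul_self_ne_zero {ι κ : Type*} [Fintype ι] [Fintype κ] [DecidableEq κ]
    {A : Matrix ι κ ℤ} (hA : Function.Injective A.mulVec) : (Aᵀ * A).det ≠ 0 := by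
  intro h
  obtain ⟨v, hv, hv0⟩ := Matrix.exists_mulVec_eq_zero_iff.2 h
  refine hv (hA ?_)
  rw [Matrix.mulVec_zero, ← dotProduct_self_eq_zero, Matrix.dotProduct_mulVec,
    ← Matrix.mulVec_transpose, Matrix.mulVec_mulVec, hv0, zero_dotProduct]

/-- Minkowski's theorem combined with cube slicing. -/
theorem exists_int_ne_zero_abs_mulVec_le {ι : Type*} [Fintype ι] {d : ℕ} (hd : d ≠ 0)
    (A : Matrix ι (Fin d) ℝ) (hA : (Aᵀ * A).det ≠ 0) {R : ℝ} (hR : 0 < R)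
    (h : √(Aᵀ * A).det ≤ R ^ d) :
    ∃ z : Fin d → ℤ, z ≠ 0 ∧ ∀ i, |(A *ᵥ fun j => (z j : ℝ)) i| ≤ R := by
  classical
  have : Nonempty (Fin d) := ⟨⟨0, Nat.pos_of_ne_zero hd⟩⟩
  have hdet : 0 < √(Aᵀ * A).det :=
    Real.sqrt_pos.2 (lt_of_le_of_ne (Matrix.posSemidef_conjTranspose_mul_self A).det_nonneg hA.symm)
  set s : Set (Fin d → ℝ) := {x | ∀ i, |(A *ᵥ x) i| ≤ R} with hs
  have hs' : s = A.mulVecLin ⁻¹' Icc (fun _ => -R) (fun _ => R) := by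
    ext x
    simp [hs, abs_le, Pi.le_def, forall_and]
  have hcpt : IsCompact s := by
    rw [hs']
    exact (LinearMap.isClosedEmbedding_of_injective (LinearMap.ker_eq_bot.2
      (Matrix.mulVec_injective_of_det_transpose_mul_self_ne_zero hA))).isCompact_preimage
        isCompact_Icc
  have hconv : Convex ℝ s := by
    rw [hs']
    exact (convex_Icc _ _).linear_preimage _
  have hvol : (2 : ℝ≥0∞) ^ d ≤ volume s := by
    have hsc : s = (2 * R) • {x : Fin d → ℝ | ∀ i, |(A *ᵥ x) i| ≤ 1 / 2} := by
      ext x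
      rw [Set.mem_smul_set_iff_inv_smul_mem₀ (by positivity)]
      simp only [hs, mem_ofPred_eq, Matrix.mulVec_smul, Pi.smul_apply, smul_eq_mul, abs_mul, abs_inv,
        abs_of_pos (show 0 < 2 * R by positivity)]
      refine forall_congr' fun i => ?_
      rw [inv_mul_le_iff₀ (by positivity)]
      ring_nf
    rw [hsc, Measure.addHaar_smul, Module.finrank_fin_fun, abs_of_pos (by positivity)]
    calc (2 : ℝ≥0∞) ^ d = ENNReal.ofReal (2 ^ d) := by simp [ENNReal.ofReal_pow]
      _ ≤ ENNReal.ofReal ((2 * R) ^ d * (√(Aᵀ * A).det)⁻¹) := by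
          refine ENNReal.ofReal_le_ofReal ?_
          rw [← div_eq_mul_inv, le_div_iff₀ hdet, mul_pow]
          gcongr
      _ ≤ _ := by
          rw [ENNReal.ofReal_mul (by positivity)]
          gcongr
          exact ofReal_inv_sqrt_det_le_volume A hA
  let b := Pi.basisFun ℝ (Fin d)
  have : Countable (Submodule.span ℤ (range b)).toAddSubgroup :=
    inferInstanceAs (Countable (Submodule.span ℤ (range b)))
  have fund := ZSpan.isAddFundamentalDomain' b volume
  obtain ⟨x, hx0, hx⟩ := exists_ne_zero_mem_lattice_of_measure_mul_two_pow_le_measure fund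
    (s := s) (fun x hx i => by rw [Matrix.mulVec_neg, Pi.neg_apply, abs_neg]; exact hx i)
    hconv hcpt (by
      rw [ZSpan.volume_fundamentalDomain, Module.finrank_fin_fun]
      have : (Matrix.of b).det = 1 := by
        have : Matrix.of b = 1 := by
          ext i j; simp [b, Pi.single_apply, Matrix.one_apply, eq_comm]
        rw [this, Matrix.det_one]
      simpa [this] using hvol)
  obtain ⟨x, hxL⟩ := x
  have hxi : ∀ j, ∃ n : ℤ, (n : ℝ) = x j := fun j => by
    simpa [b] using (b.mem_span_iff_repr_mem ℤ x).1 hxL j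
  choose z hz using hxi
  obtain rfl : (fun j => (z j : ℝ)) = x := funext hz
  refine ⟨z, ?_, hx⟩
  rintro rfl
  exact hx0 (Subtype.ext (by ext; simp))

lemma Matrix.dvd_det_mul {R : Type*} [CommRing R] {n m : ℕ} (g : R)
    (M : Matrix (Fin n) (Fin m) R) (B : Matrix (Fin m) (Fin n) R)
    (hg : ∀ f : Fin n ↪ Fin m, g ∣ (M.submatrix id f).det) : g ∣ (M * B).det := by
  classical
  have h : (M * B).det = ∑ r : Fin n → Fin m, (∏ i, B (r i) i) * (M.submatrix id r).det := by
    rw [← Matrix.det_transpose]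
    have : (M * B)ᵀ = fun i => ∑ k, B k i • Mᵀ k := by
      ext i j
      simp [Matrix.mul_apply, mul_comm]
    rw [this]
    change Matrix.detRowAlternating.toMultilinearMap _ = _
    rw [MultilinearMap.map_sum]
    refine Finset.sum_congr rfl fun r _ => ?_
    rw [MultilinearMap.map_smul_univ, smul_eq_mul]
    congr 1
    rw [← Matrix.det_transpose]
    rfl
  rw [h]
  refine Finset.dvd_sum fun r _ => Dvd.dvd.mul_left ?_ _
  by_cases hr : Function.Injective r
  · exact hg ⟨r, hr⟩
  · simp only [Function.Injective, not_forall] at hr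
    obtain ⟨i, j, hij, hne⟩ := hr
    rw [Matrix.det_zero_of_column_eq hne fun k => by simp [hij]]
    exact dvd_zero g

/-- The kernel of an integer matrix of full row rank is a direct summand: the matrices `A` and `B`
of bases of the kernel and of a complement form an invertible matrix. -/
lemma exists_kernel_complement_matrix {n m : ℕ} (M : Matrix (Fin n) (Fin m) ℤ)
    (hM : Function.Injective Mᵀ.mulVec) :
    ∃ (A : Matrix (Fin m) (Fin (m - n)) ℤ) (B : Matrix (Fin m) (Fin n) ℤ)
      (V : Matrix (Fin (m - n) ⊕ Fin n) (Fin m) ℤ), M * A = 0 ∧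
        Matrix.fromCols A B * V = 1 ∧ V * Matrix.fromCols A B = 1 := by
  set f := M.mulVecLin with hf
  set K := LinearMap.ker f
  set I := LinearMap.range f
  obtain ⟨σ, hσ⟩ := Module.projective_lifting_property f.rangeRestrict LinearMap.id
    f.surjective_rangeRestrict
  have hσ' : ∀ y, f (σ y) = y := fun y => congrArg Subtype.val (LinearMap.congr_fun hσ y)
  let e : (K × I) ≃ₗ[ℤ] (Fin m → ℤ) := LinearEquiv.ofBijective (K.subtype.coprod σ) <| by
    constructor
    · rw [← LinearMap.ker_eq_bot, LinearMap.ker_eq_bot']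
      rintro ⟨x, y⟩ hxy
      have hxy' : (x : Fin m → ℤ) + σ y = 0 := by simpa using hxy
      have hx : f x = 0 := x.2
      have hy : y = 0 := by
        have := congrArg f hxy'
        rw [map_add, hx, hσ', map_zero, zero_add] at this
        exact Subtype.ext this
      subst hy
      rw [map_zero, add_zero] at hxy'
      exact Prod.ext (Subtype.ext hxy') rfl
    · intro x
      refine ⟨(⟨x - σ (f.rangeRestrict x), ?_⟩, f.rangeRestrict x), by simp⟩
      rw [LinearMap.mem_ker, map_sub, hσ']
      exact sub_self _
  have hI : Module.finrank ℤ I = n := by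
    refine le_antisymm ((Submodule.finrank_le I).trans_eq (by simp)) ?_
    have hinj : Function.Injective (f.rangeRestrict ∘ₗ Mᵀ.mulVecLin) := by
      intro x y hxy
      have : (M * Mᵀ) *ᵥ x = (M * Mᵀ) *ᵥ y := by
        have h := congrArg Subtype.val hxy
        change M *ᵥ (Mᵀ *ᵥ x) = M *ᵥ (Mᵀ *ᵥ y) at h
        rwa [Matrix.mulVec_mulVec, Matrix.mulVec_mulVec] at h
      have hd := Matrix.det_transpose_mul_self_ne_zero hM
      rw [Matrix.transpose_transpose] at hd
      rw [← sub_eq_zero, ← Matrix.mulVec_sub] at this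
      exact sub_eq_zero.1 (Matrix.eq_zero_of_mulVec_eq_zero hd this)
    simpa using LinearMap.finrank_le_finrank_of_injective hinj
  have hK : Module.finrank ℤ K = m - n := by
    have := e.finrank_eq
    rw [Module.finrank_prod, hI, Module.finrank_fin_fun] at this
    omega
  let bK := Module.finBasisOfFinrankEq ℤ K hK
  let bI := Module.finBasisOfFinrankEq ℤ I hI
  let b := (bK.prod bI).map e
  let U := (Pi.basisFun ℤ (Fin m)).toMatrix b
  refine ⟨U.toCols₁, U.toCols₂, b.toMatrix (Pi.basisFun ℤ (Fin m)), ?_, ?_, ?_⟩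
  · ext i j
    have hj : b (Sum.inl j) = (bK j : Fin m → ℤ) := by
      have he : e (bK j, 0) = K.subtype (bK j) + σ 0 := rfl
      simpa [b] using he
    have := congrFun (show M *ᵥ (bK j : Fin m → ℤ) = 0 from (bK j).2) i
    rw [← hj] at this
    simpa [Matrix.mul_apply, Matrix.mulVec, dotProduct, U, Module.Basis.toMatrix_apply] using this
  · rw [Matrix.fromCols_toCols]
    exact Module.Basis.toMatrix_mul_toMatrix_flip _ _
  · rw [Matrix.fromCols_toCols]
    exact Module.Basis.toMatrix_mul_toMatrix_flip _ _

lemma Matrix.mulVec_injective_of_mul_fromCols_eq_one {κ ι ν : Type*} [Fintype κ] [Fintype ι]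
    [Fintype ν] [DecidableEq κ] [DecidableEq ν] {A : Matrix ι κ ℤ} {B : Matrix ι ν ℤ}
    {V : Matrix (κ ⊕ ν) ι ℤ} (h : V * Matrix.fromCols A B = 1) :
    Function.Injective A.mulVec := by
  have h1 : V.toRows₁ * A = 1 := by
    rw [← Matrix.fromRows_toRows V, Matrix.fromRows_mul_fromCols, ← Matrix.fromBlocks_one,
      Matrix.fromBlocks_inj] at h
    exact h.1
  intro x y hxy
  have := congrArg (V.toRows₁ *ᵥ ·) hxy
  simpa [Matrix.mulVec_mulVec, h1] using this

/-- The relation between the Gram determinants of a matrix `M` and of a basis `A` of its kernel. -/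
lemma abs_det_mul_transpose_eq {κ ι ν : Type*} [Fintype κ] [Fintype ι]
    [Fintype ν] [DecidableEq κ] [DecidableEq ι] [DecidableEq ν] {M : Matrix ν ι ℤ}
    {A : Matrix ι κ ℤ} {B : Matrix ι ν ℤ} {V : Matrix (κ ⊕ ν) ι ℤ} (hMA : M * A = 0)
    (h : Matrix.fromCols A B * V = 1) (h' : V * Matrix.fromCols A B = 1) :
    |(M * Mᵀ).det| = |(Aᵀ * A).det| * (M * B).det ^ 2 := by
  set U := Matrix.fromCols A B with hU
  set P := Matrix.fromCols A Mᵀ with hP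
  have hAM : Aᵀ * Mᵀ = 0 := by rw [← Matrix.transpose_mul, hMA, Matrix.transpose_zero]
  have hPP : (Pᵀ * P).det = (Aᵀ * A).det * (M * Mᵀ).det := by
    rw [hP, Matrix.transpose_fromCols, Matrix.fromRows_mul_fromCols, Matrix.transpose_transpose,
      hMA, Matrix.det_fromBlocks_zero₂₁]
  have hPU : (Pᵀ * U).det = (Aᵀ * A).det * (M * B).det := by
    rw [hP, hU, Matrix.transpose_fromCols, Matrix.fromRows_mul_fromCols,
      Matrix.transpose_transpose, hMA, Matrix.det_fromBlocks_zero₂₁]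
  have hVV : |(V * Vᵀ).det| = 1 := by
    refine Int.isUnit_iff_abs_eq.1 (.of_mul_eq_one (Uᵀ * U).det ?_)
    rw [← Matrix.det_mul, Matrix.mul_assoc, ← Matrix.mul_assoc Vᵀ, ← Matrix.transpose_mul, h,
      Matrix.transpose_one, Matrix.one_mul, h', Matrix.det_one]
  have hPUV : Pᵀ * P = (Pᵀ * U) * (V * Vᵀ) * (Pᵀ * U)ᵀ := by
    have h2 : Vᵀ * Uᵀ = 1 := by rw [← Matrix.transpose_mul, h, Matrix.transpose_one]
    calc Pᵀ * P = Pᵀ * (U * V) * (Vᵀ * Uᵀ) * P := by rw [h, h2, Matrix.mul_one, Matrix.mul_one]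
      _ = _ := by
        rw [Matrix.transpose_mul, Matrix.transpose_transpose]
        simp only [Matrix.mul_assoc]
  have key := congrArg (fun X => |Matrix.det X|) hPUV
  simp only [Matrix.det_mul _ (Pᵀ * U)ᵀ, Matrix.det_mul _ (V * Vᵀ), Matrix.det_transpose, hPP,
    hPU, abs_mul, hVV, mul_one] at key
  have hA : |(Aᵀ * A).det| ≠ 0 := abs_ne_zero.2
    (Matrix.det_transpose_mul_self_ne_zero (Matrix.mulVec_injective_of_mul_fromCols_eq_one h'))
  refine mul_left_cancel₀ hA ?_
  rw [key, ← sq_abs (M * B).det]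
  ring

lemma det_map_intCast_transpose_mul_self {ι κ : Type*} [Fintype ι] [Fintype κ] [DecidableEq κ]
    (A : Matrix ι κ ℤ) :
    ((A.map ((↑) : ℤ → ℝ))ᵀ * A.map ((↑) : ℤ → ℝ)).det = ((Aᵀ * A).det : ℤ) := by
  have h := (RingHom.map_det (Int.castRingHom ℝ) (Aᵀ * A)).symm
  rwa [RingHom.mapMatrix_apply, Matrix.map_mul, Matrix.transpose_map] at h

lemma Matrix.det_transpose_mul_self_int_nonneg {ι κ : Type*} [Fintype ι] [Fintype κ]
    [DecidableEq κ] (A : Matrix ι κ ℤ) : 0 ≤ (Aᵀ * A).det := by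
  have h := (Matrix.posSemidef_conjTranspose_mul_self (A.map ((↑) : ℤ → ℝ))).det_nonneg
  rw [Matrix.conjTranspose_eq_transpose_of_trivial, det_map_intCast_transpose_mul_self] at h
  exact_mod_cast h

/-- **Bombieri–Vaaler theorem (Siegel's lemma, sharpened).**
Let `n < m` and let `M` be an `n × m` integer matrix of full row rank `n`
(expressed by saying that its rows are linearly independent).  Let `g` be the
gcd of all `n × n` minors of `M` (the determinants of the submatrices obtained
by selecting `n` of the `m` columns, here parametrized by embeddings
`Fin n ↪ Fin m`); then `g > 0`.  There is a nonzero integer vector `x` with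
`M x = 0` whose sup-norm is at most `((1/g) * √(det (M Mᵀ)))^(1/(m-n))`. -/
theorem bombieri_vaaler (n m : ℕ) (hn : 0 < n) (hnm : n < m)
    (M : Matrix (Fin n) (Fin m) ℤ)
    (hrank : LinearIndependent ℤ (fun i : Fin n => M i))
    (g : ℤ)
    (hg : g = Finset.univ.gcd (fun f : Fin n ↪ Fin m => (M.submatrix id f).det)) :
    0 < g ∧
    ∃ x : Fin m → ℤ, x ≠ 0 ∧ M.mulVec x = 0 ∧
      ∀ j : Fin m, (|x j| : ℝ) ≤
        ((1 / (g : ℝ)) * Real.sqrt (((M * M.transpose).det : ℤ) : ℝ))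
          ^ ((1 : ℝ) / ((m : ℝ) - (n : ℝ))) := by
  have hM : Function.Injective Mᵀ.mulVec := by
    have := Matrix.vecMul_injective_iff.2 hrank
    exact fun x y hxy => this (by simpa only [Matrix.mulVec_transpose] using hxy)
  obtain ⟨A, B, V, hMA, hUV, hVU⟩ := exists_kernel_complement_matrix M hM
  have hAinj := Matrix.mulVec_injective_of_mul_fromCols_eq_one hVU
  have hA0 := Matrix.det_transpose_mul_self_ne_zero hAinj
  have hM0 := Matrix.det_transpose_mul_self_ne_zero hM
  have hMpos := Matrix.det_transpose_mul_self_int_nonneg Mᵀ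
  have hApos := Matrix.det_transpose_mul_self_int_nonneg A
  rw [Matrix.transpose_transpose] at hM0 hMpos
  have hrel := abs_det_mul_transpose_eq hMA hUV hVU
  rw [abs_of_nonneg hMpos, abs_of_nonneg hApos] at hrel
  have hN0 : (M * B).det ≠ 0 := by
    intro h
    exact hM0 (by rw [hrel, h]; simp)
  have hdvd : g ∣ (M * B).det := Matrix.dvd_det_mul g M B fun f =>
    hg ▸ Finset.gcd_dvd (Finset.mem_univ f)
  have hg0 : 0 < g := by
    refine lt_of_le_of_ne ?_ fun h => hN0 (zero_dvd_iff.1 (h ▸ hdvd))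
    rw [hg]
    exact (Int.nonneg_iff_normalize_eq_self _).1 Finset.normalize_gcd
  refine ⟨hg0, ?_⟩
  have hgN : g ^ 2 ≤ (M * B).det ^ 2 :=
    sq_le_sq.2 ((abs_of_pos hg0).trans_le
      (Int.le_of_dvd (abs_pos.2 hN0) ((dvd_abs _ _).2 hdvd)))
  have hle : (Aᵀ * A).det * g ^ 2 ≤ (M * Mᵀ).det := by
    rw [hrel]
    exact mul_le_mul_of_nonneg_left hgN hApos
  have hgR : (0 : ℝ) < g := by exact_mod_cast hg0
  have hMR : (0 : ℝ) < ((M * Mᵀ).det : ℤ) := by exact_mod_cast lt_of_le_of_ne hMpos hM0.symm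
  set c : ℝ := 1 / (g : ℝ) * √(((M * Mᵀ).det : ℤ) : ℝ) with hc
  have hcpos : 0 < c := mul_pos (one_div_pos.2 hgR) (Real.sqrt_pos.2 hMR)
  have hsub : ((m : ℝ) - n) = ((m - n : ℕ) : ℝ) := by rw [Nat.cast_sub hnm.le]
  have hd : m - n ≠ 0 := Nat.sub_ne_zero_of_lt hnm
  obtain ⟨z, hz0, hz⟩ := exists_int_ne_zero_abs_mulVec_le hd (A.map ((↑) : ℤ → ℝ))
    (by rw [det_map_intCast_transpose_mul_self]; exact_mod_cast hA0)
    (R := c ^ (1 / ((m : ℝ) - n))) (Real.rpow_pos_of_pos hcpos _) (by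
      rw [hsub, one_div, Real.rpow_inv_natCast_pow hcpos.le hd, det_map_intCast_transpose_mul_self,
        hc, one_div_mul_eq_div, le_div_iff₀ hgR]
      refine Real.le_sqrt_of_sq_le ?_
      rw [mul_pow, Real.sq_sqrt (by exact_mod_cast hApos)]
      exact_mod_cast hle)
  refine ⟨A *ᵥ z, fun h => hz0 (hAinj (by rw [h, Matrix.mulVec_zero])), ?_, fun j => ?_⟩
  · rw [Matrix.mulVec_mulVec, hMA, Matrix.zero_mulVec]
  · convert hz j using 2
    simp [Matrix.mulVec, dotProduct]
end

section
/- Let D_n = ∑_{k=0}^{n} binomial(n, k) · binomial(n+k, k) denote the n-th central Delannoy number. Then for every natural number n, (n+2)·D_{n+2} − (6n+9)·D_{n+1} + (n+1)·D_n = 0. -/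
/-- The summand of the central Delannoy number `D_n`, as an integer. -/
def delannoySummand (n k : ℕ) : ℤ := (n.choose k * (n + k).choose k : ℕ)

theorem delannoySummand_eq_zero {n k : ℕ} (h : n < k) : delannoySummand n k = 0 := by
  simp [delannoySummand, Nat.choose_eq_zero_of_lt h]

theorem sq_mul_delannoySummand_succ_right (n k : ℕ) :
    ((k : ℤ) + 1) ^ 2 * delannoySummand n (k + 1) =
      ((n : ℤ) - k) * (n + k + 1) * delannoySummand n k := by
  rcases lt_or_ge n k with h | h
  · simp [delannoySummand_eq_zero h, delannoySummand_eq_zero (Nat.lt_succ_of_lt h)]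
  · have h₁ : (n.choose (k + 1) : ℤ) * (k + 1) = n.choose k * (n - k) := by
      have := Nat.choose_succ_right_eq n k
      zify [h] at this
      exact this
    have h₂ : ((n : ℤ) + k + 1) * (n + k).choose k = (n + (k + 1)).choose (k + 1) * (k + 1) := by
      exact_mod_cast Nat.add_one_mul_choose_eq (n + k) k
    simp only [delannoySummand, Nat.cast_mul]
    linear_combination ((k : ℤ) + 1) * (n + (k + 1)).choose (k + 1) * h₁ -
      (n.choose k : ℤ) * (n - k) * h₂

theorem sub_mul_delannoySummand_succ_left (n k : ℕ) :
    ((n : ℤ) + 1 - k) * delannoySummand (n + 1) k = (n + 1 + k) * delannoySummand n k := by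
  rcases lt_or_ge (n + 1) k with h | h
  · simp [delannoySummand_eq_zero h, delannoySummand_eq_zero (Nat.lt_of_succ_lt h)]
  · have h₁ : (n.choose k : ℤ) * (n + 1) = (n + 1).choose k * (n + 1 - k) := by
      have := Nat.choose_mul_succ_eq n k
      zify [h] at this
      exact this
    have h₂ : ((n + k).choose k : ℤ) * (n + k + 1) = (n + 1 + k).choose k * (n + 1) := by
      have := Nat.choose_mul_succ_eq (n + k) k
      rw [show n + k + 1 - k = n + 1 by omega, show n + k + 1 = n + 1 + k by omega] at this
      zify at this
      linear_combination this
    have h₀ : (n : ℤ) + 1 ≠ 0 := by positivity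
    apply mul_left_cancel₀ h₀
    simp only [delannoySummand, Nat.cast_mul]
    linear_combination -((n : ℤ) + 1) * (n + 1 + k).choose k * h₁ -
      (n.choose k : ℤ) * (n + 1) * h₂

/-- The coefficientwise form of Bonnet's recurrence for the shifted Legendre polynomials. -/
theorem delannoySummand_recurrence (n k : ℕ) :
    ((n : ℤ) + 2) * delannoySummand (n + 2) (k + 1) + (n + 1) * delannoySummand n (k + 1) =
      (2 * n + 3) * (delannoySummand (n + 1) (k + 1) + 2 * delannoySummand (n + 1) k) := by
  have h₀ : ((k : ℤ) + 1) ^ 2 ≠ 0 := by positivity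
  apply mul_left_cancel₀ h₀
  have r₀ := sq_mul_delannoySummand_succ_right n k
  have r₁ := sq_mul_delannoySummand_succ_right (n + 1) k
  have r₂ := sq_mul_delannoySummand_succ_right (n + 2) k
  have l₀ := sub_mul_delannoySummand_succ_left n k
  have l₁ := sub_mul_delannoySummand_succ_left (n + 1) k
  push_cast at r₁ r₂ l₁
  linear_combination ((n : ℤ) + 2) * r₂ + (n + 1) * r₀ - (2 * n + 3) * r₁ -
    ((n : ℤ) + 1) * (n - k) * l₀ + ((n : ℤ) + 2) * (n + k + 3) * l₁

theorem sum_range_delannoySummand {n m : ℕ} (h : n < m) :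
    ∑ k ∈ Finset.range m, delannoySummand n k =
      ∑ k ∈ Finset.range (n + 1), delannoySummand n k := by
  symm
  apply Finset.sum_subset (Finset.range_subset_range.2 h)
  intro k _ hk
  exact delannoySummand_eq_zero (by rw [Finset.mem_range] at hk; omega)

/-- The central Delannoy numbers `D_n = ∑_{k=0}^n (n choose k)·((n+k) choose k)`
satisfy the recurrence `(n+2)·D_{n+2} − (6n+9)·D_{n+1} + (n+1)·D_n = 0`. -/
theorem central_delannoy_recurrence
    (D : ℕ → ℕ)
    (hD : ∀ n : ℕ, D n = ∑ k ∈ Finset.range (n + 1),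
      Nat.choose n k * Nat.choose (n + k) k) :
    ∀ n : ℕ,
      ((n + 2 : ℕ) : ℤ) * (D (n + 2) : ℤ)
        - ((6 * n + 9 : ℕ) : ℤ) * (D (n + 1) : ℤ)
        + ((n + 1 : ℕ) : ℤ) * (D n : ℤ) = 0 := by
  intro n
  have hS (j m : ℕ) (h : j < m) : (D j : ℤ) = ∑ k ∈ Finset.range m, delannoySummand j k := by
    rw [sum_range_delannoySummand h, hD, Nat.cast_sum]
    rfl
  have hzero (j : ℕ) : delannoySummand j 0 = 1 := by simp [delannoySummand]
  have hsum := Finset.sum_congr rfl fun k (_ : k ∈ Finset.range (n + 2)) ↦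
    delannoySummand_recurrence n k
  simp only [Finset.sum_add_distrib, ← Finset.mul_sum] at hsum
  have e₀ := hS n (n + 3) (by omega)
  have e₁ := hS (n + 1) (n + 3) (by omega)
  have e₂ := hS (n + 2) (n + 3) (by omega)
  have e₁' := hS (n + 1) (n + 2) (by omega)
  rw [Finset.sum_range_succ', hzero] at e₀ e₁ e₂
  push_cast
  linear_combination hsum + ((n : ℤ) + 2) * e₂ + (n + 1) * e₀ - (2 * n + 3) * e₁ -
    2 * (2 * (n : ℤ) + 3) * e₁'
end
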